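/- In every trace of the p-player Hanabi bookkeeping model, the total number of play and discard turns is at most d₀ + p. -/

import Mathlib

/-- A state of the Hanabi bookkeeping model:
`m` hint tokens, `d` cards left in the deck, `q` remaining turns once the
deck is empty, `f` completed fireworks, `s` score. -/
structure HState where
  m : ℕ
  d : ℕ
  q : ℕ
  f : ℕ
  s : ℕ

/-- The invariants a state must satisfy. -/
def HState.valid (st : HState) : Prop :=
  st.m ≤ 8 ∧ st.f ≤ 5 ∧ 5 * st.f ≤ st.s ∧ st.s ≤ 20 + st.f

/-- The possible kinds of turns. -/
inductive HAction where
  | hint | discard | playFail | playSucc | playComplete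
deriving DecidableEq

/-- Is the action a play (successful or not, possibly firework-completing)? -/
def HAction.isPlay : HAction → Prop
  | .hint => False
  | .discard => False
  | _ => True

instance : DecidablePred HAction.isPlay := by
  intro a; cases a <;> simp [HAction.isPlay] <;> infer_instance

/-- A turn of kind `a` from state `st` to state `st'`. -/
def Step (a : HAction) (st st' : HState) : Prop :=
  st.valid ∧ st'.valid ∧
  -- a turn is allowed only if the score is below 25 and the game is not over
  st.s < 25 ∧ (1 ≤ st.d ∨ 1 ≤ st.q) ∧
  -- update of the deck size and of the remaining-turns counter
  st'.d = (if 1 ≤ st.d ∧ a ≠ .hint then st.d - 1 else st.d) ∧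
  st'.q = (if st.d = 0 then st.q - 1 else st.q) ∧
  -- effect of the individual actions
  (match a with
  | .hint => 1 ≤ st.m ∧ st'.m = st.m - 1 ∧ st'.f = st.f ∧ st'.s = st.s
  | .discard => st.m ≤ 7 ∧ st'.m = st.m + 1 ∧ st'.f = st.f ∧ st'.s = st.s
  | .playFail => st'.m = st.m ∧ st'.f = st.f ∧ st'.s = st.s
  | .playSucc => st'.m = st.m ∧ st'.f = st.f ∧ st'.s = st.s + 1
  | .playComplete =>
      st.f ≤ 4 ∧ st'.m = min (st.m + 1) 8 ∧ st'.f = st.f + 1 ∧ st'.s = st.s + 1)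

/-- Hand size for `p` players. -/
def handSize (p : ℕ) : ℕ := if p ≤ 3 then 5 else 4

/-- Initial deck size for `p` players. -/
def initialDeck (p : ℕ) : ℕ := 50 - p * handSize p

/-- The initial state for `p` players. -/
def initState (p : ℕ) : HState := ⟨8, initialDeck p, p, 0, 0⟩

/-- A trace of length `n` (i.e. with `n` turns) of the `p`-player Hanabi
bookkeeping model: `n + 1` states starting at the initial state, with
consecutive states related by turns. -/
structure Trace (p n : ℕ) where
  state : Fin (n + 1) → HState
  action : Fin n → HAction
  init : state 0 = initState p
  step : ∀ t : Fin n, Step (action t) (state t.castSucc) (state t.succ)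

/-- A natural-number potential that never increases along a sequence, and drops at every index
satisfying `P`, bounds the number of such indices by its initial value. -/
theorem card_filter_add_last_le_of_potential {n : ℕ} (u : Fin (n + 1) → ℕ) (P : Fin n → Prop)
    [DecidablePred P]
    (h : ∀ t : Fin n, u t.succ + (if P t then 1 else 0) ≤ u t.castSucc) :
    (Finset.univ.filter P).card + u (Fin.last n) ≤ u 0 := by
  rw [Finset.card_filter]
  induction n with
  | zero => simp
  | succ k ih =>
    have h₀ := h 0
    have h₁ := ih (fun i => u i.succ) (fun i => P i.succ) fun t => h t.succ
    rw [Fin.sum_univ_succ]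
    simp only [Fin.castSucc_zero, Fin.succ_last, Nat.succ_eq_add_one] at h₀ h₁
    omega

/-- Cards in the deck plus remaining turns never increase, and drop on a play or discard. -/
theorem Step.deck_add_turns_le {a : HAction} {st st' : HState} (h : Step a st st') :
    st'.d + st'.q + (if a ≠ .hint then 1 else 0) ≤ st.d + st.q := by
  obtain ⟨-, -, -, hturn, hd, hq, -⟩ := h
  by_cases ha : a = .hint <;> simp only [ha, ne_eq, not_true_eq_false, not_false_eq_true,
    and_true, and_false, if_true, if_false] at hd ⊢ <;> split_ifs at hd hq <;> omega

/-- In every trace of the `p`-player Hanabi bookkeeping model, the total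
number of play and discard turns is at most `d₀ + p`. -/
theorem hanabi_card_turns_le (p : ℕ) (hp₂ : 2 ≤ p) (hp₅ : p ≤ 5)
    (n : ℕ) (tr : Trace p n) :
    (Finset.univ.filter fun t : Fin n =>
        tr.action t ≠ .hint).card ≤ initialDeck p + p := by
  have h := card_filter_add_last_le_of_potential (fun i => (tr.state i).d + (tr.state i).q)
    (fun t => tr.action t ≠ .hint) fun t => (tr.step t).deck_add_turns_le
  simp only [tr.init, initState] at h
  omega
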